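/- arXiv:2509.18854 — 6 statements merged into one kernel-verified Lean document; each statement's English description precedes it below -/
import Mathlib

section
/- Let μ be a Borel probability measure on ℝ with finite second moment and let δ ∈ (0,1). Then there exists a Borel probability measure ν on ℝ with finite second moment such that the total variation distance sup_{A Borel} |μ(A) − ν(A)| is at most δ and 2·σ(ν) ≤ diam^δ(μ), where σ(ν) is the standard deviation of ν. -/
open MeasureTheory

/-- The `δ`-diameter of a Borel probability measure on `ℝ`: the infimum of the lengths of
intervals `[R₁, R₂]` carrying mass at least `1 - δ`. -/
noncomputable def deltaDiam (μ : Measure ℝ) (δ : ℝ) : ℝ :=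
  sInf {d : ℝ | ∃ R₁ R₂ : ℝ, R₁ ≤ R₂ ∧ d = R₂ - R₁ ∧
    ENNReal.ofReal (1 - δ) ≤ μ (Set.Icc R₁ R₂)}

open Set Filter Topology in
/-- If the closed intervals `[aₙ, bₙ]` converge to `[a, b]` and all have mass at least `c`, then
so does `[a, b]`. -/
theorem le_measure_Icc_of_tendsto {μ : Measure ℝ} [IsFiniteMeasure μ] {c : ENNReal}
    {u v : ℕ → ℝ} {a b : ℝ} (hu : Tendsto u atTop (𝓝 a)) (hv : Tendsto v atTop (𝓝 b))
    (h : ∀ n, c ≤ μ (Icc (u n) (v n))) : c ≤ μ (Icc a b) := by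
  have hbig : ∀ ε > 0, c ≤ μ (Icc (a - ε) (b + ε)) := by
    intro ε hε
    obtain ⟨n, hn₁, hn₂⟩ := ((hu.eventually (lt_mem_nhds (sub_lt_self a hε))).and
      (hv.eventually (gt_mem_nhds (lt_add_of_pos_right b hε)))).exists
    exact (h n).trans (measure_mono (Icc_subset_Icc hn₁.le hn₂.le))
  let s : ℕ → Set ℝ := fun n => Icc (a - 1 / ((n : ℝ) + 1)) (b + 1 / ((n : ℝ) + 1))
  have hs : Antitone s := fun m n hmn => by
    have := Nat.one_div_le_one_div (α := ℝ) hmn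
    exact Icc_subset_Icc (by linarith) (by linarith)
  have hInter : ⋂ n, s n ⊆ Icc a b := by
    intro x hx
    have hx' : ∀ n : ℕ, x ∈ s n := mem_iInter.1 hx
    have h0 := tendsto_one_div_add_atTop_nhds_zero_nat (𝕜 := ℝ)
    constructor
    · exact le_of_tendsto' (by simpa using h0.const_sub a) fun n => (hx' n).1
    · exact ge_of_tendsto' (by simpa using h0.const_add b) fun n => (hx' n).2
  have hlim := tendsto_measure_iInter_atTop (μ := μ) (s := s)
    (fun n => measurableSet_Icc.nullMeasurableSet) hs ⟨0, measure_ne_top _ _⟩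
  exact (ge_of_tendsto' hlim fun n => hbig _ Nat.one_div_pos_of_nat).trans (measure_mono hInter)

open Set in
/-- A finite measure on `ℝ` has little mass outside a large enough interval `[-M, M]`. -/
theorem exists_measure_compl_Icc_le (μ : Measure ℝ) [IsFiniteMeasure μ] {ε : ENNReal}
    (hε : 0 < ε) : ∃ M : ℝ, 0 ≤ M ∧ μ (Icc (-M) M)ᶜ ≤ ε := by
  obtain ⟨K, hK, hKε⟩ := isTightMeasureSet_iff_exists_isCompact_measure_compl_le.1
    (isTightMeasureSet_singleton (μ := μ)) ε hε
  obtain ⟨M, hM, hKM⟩ := hK.isBounded.exists_pos_norm_le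
  refine ⟨M, hM.le, (measure_mono (compl_subset_compl.2 fun x hx => ?_)).trans (hKε μ rfl)⟩
  exact abs_le.1 (hKM x hx)

open Set Filter Topology in
/-- The infimum defining the `δ`-diameter of a probability measure is attained. -/
theorem exists_Icc_length_eq_deltaDiam (μ : Measure ℝ) [IsProbabilityMeasure μ] {δ : ℝ}
    (hδ0 : 0 < δ) (hδ1 : δ < 1) :
    ∃ a b : ℝ, a ≤ b ∧ b - a = deltaDiam μ δ ∧ ENNReal.ofReal (1 - δ) ≤ μ (Icc a b) := by
  set S := {d : ℝ | ∃ R₁ R₂ : ℝ, R₁ ≤ R₂ ∧ d = R₂ - R₁ ∧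
    ENNReal.ofReal (1 - δ) ≤ μ (Icc R₁ R₂)} with hS
  have hne : S.Nonempty := by
    obtain ⟨M, hM, h⟩ := exists_measure_compl_Icc_le μ (ENNReal.ofReal_pos.2 hδ0)
    refine ⟨M - -M, -M, M, by linarith, rfl, ?_⟩
    rw [ENNReal.ofReal_sub _ hδ0.le, ENNReal.ofReal_one, tsub_le_iff_right,
      ← prob_add_prob_compl (μ := μ) (measurableSet_Icc (a := -M) (b := M))]
    gcongr
  have hbdd : BddBelow S := ⟨0, by rintro _ ⟨R₁, R₂, h, rfl, -⟩; linarith⟩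
  obtain ⟨d, hd_anti, hd, hdS⟩ := exists_seq_tendsto_sInf hne hbdd
  choose u v huv hduv hmass using hdS
  obtain ⟨M, hM, hMmass⟩ := exists_measure_compl_Icc_le μ (ε := ENNReal.ofReal ((1 - δ) / 2))
    (ENNReal.ofReal_pos.2 (by linarith))
  have hu : ∀ n, u n ∈ Icc (-M - d 0) M := by
    intro n
    have hmeet : ∃ x ∈ Icc (u n) (v n), x ∈ Icc (-M) M := by
      by_contra! h
      have h₁ := (hmass n).trans ((measure_mono h).trans hMmass)
      rw [ENNReal.ofReal_le_ofReal_iff (by linarith)] at h₁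
      linarith
    obtain ⟨x, ⟨hx₁, hx₂⟩, hx₃, hx₄⟩ := hmeet
    have h₀ := hd_anti (Nat.zero_le n)
    have h₁ := hduv n
    exact ⟨by linarith, by linarith⟩
  obtain ⟨a, -, φ, hφ, hlim⟩ := isCompact_Icc.tendsto_subseq hu
  have hv : Tendsto (v ∘ φ) atTop (𝓝 (a + sInf S)) :=
    (hlim.add (hd.comp hφ.tendsto_atTop)).congr fun n => by simp [hduv]
  refine ⟨a, a + sInf S, ?_, add_sub_cancel_left _ _,
    le_measure_Icc_of_tendsto hlim hv fun n => hmass _⟩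
  exact le_of_tendsto_of_tendsto' hlim hv fun n => huv _

/-- If two preimages agree on `s`, their measures differ by at most the mass of `sᶜ`. -/
theorem abs_measureReal_sub_measureReal_le_compl {α : Type*} [MeasurableSpace α] {μ : Measure α}
    [IsFiniteMeasure μ] {A B s : Set α} (h : ∀ x ∈ s, x ∈ A ↔ x ∈ B) :
    |μ.real A - μ.real B| ≤ μ.real sᶜ := by
  have key : ∀ {A B : Set α}, (∀ x ∈ s, x ∈ A → x ∈ B) → μ.real A ≤ μ.real B + μ.real sᶜ := by
    intro A B h
    refine (measureReal_mono fun x hx => ?_).trans (measureReal_union_le B sᶜ)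
    by_cases hs : x ∈ s
    · exact Or.inl (h x hs hx)
    · exact Or.inr hs
  have h₁ := key fun x hx => (h x hx).1
  have h₂ := key fun x hx => (h x hx).2
  rw [abs_le]
  constructor <;> linarith

/-- Lemma F.1(ii): there is a probability measure `ν` within total variation distance `δ`
of `μ` whose standard deviation satisfies `2 σ(ν) ≤ diam^δ(μ)`. -/
theorem exists_close_measure_two_stddev_le_deltaDiam (μ : Measure ℝ)
    [IsProbabilityMeasure μ] (hμ : Integrable (fun x => x ^ 2) μ)
    (δ : ℝ) (hδ0 : 0 < δ) (hδ1 : δ < 1) :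
    ∃ ν : Measure ℝ, IsProbabilityMeasure ν ∧ Integrable (fun x => x ^ 2) ν ∧
      (∀ A : Set ℝ, MeasurableSet A → |(μ A).toReal - (ν A).toReal| ≤ δ) ∧
      2 * Real.sqrt (ProbabilityTheory.variance id ν) ≤ deltaDiam μ δ := by
  obtain ⟨a, b, hab, hdiam, hmass⟩ := exists_Icc_length_eq_deltaDiam μ hδ0 hδ1
  let f : ℝ → ℝ := fun x => max a (min x b)
  have hf : Measurable f := by fun_prop
  have hfmem : ∀ x, f x ∈ Set.Icc a b := fun x =>
    ⟨le_max_left _ _, max_le hab (min_le_right _ _)⟩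
  have hffix : ∀ x ∈ Set.Icc a b, f x = x := fun x hx => by
    simp [f, hx.1, hx.2]
  have hν : IsProbabilityMeasure (μ.map f) := Measure.isProbabilityMeasure_map hf.aemeasurable
  have hbound : ∀ᵐ x ∂μ.map f, id x ∈ Set.Icc a b :=
    (ae_map_iff hf.aemeasurable measurableSet_Icc).2 (ae_of_all _ hfmem)
  refine ⟨μ.map f, hν, ?_, fun A hA => ?_, ?_⟩
  · exact (memLp_of_bounded hbound aestronglyMeasurable_id 2).integrable_sq
  · rw [Measure.map_apply hf hA]
    refine (abs_measureReal_sub_measureReal_le_compl (s := Set.Icc a b) fun x hx => ?_).trans ?_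
    · rw [Set.mem_preimage, hffix x hx]
    · rw [probReal_compl_eq_one_sub measurableSet_Icc]
      have := (ENNReal.ofReal_le_iff_le_toReal (measure_ne_top _ _)).1 hmass
      rw [← measureReal_def] at this
      linarith
  · have hvar := ProbabilityTheory.variance_le_sq_of_bounded hbound aemeasurable_id
    have := Real.sqrt_le_sqrt hvar
    rw [Real.sqrt_sq (by linarith)] at this
    linarith
end

section
/- Let H be a complex Hilbert space, let P and Q be the orthogonal projections onto two closed subspaces of H, let φ ∈ H with ‖φ‖ = 1, and let δ ≥ 0. If ‖Pφ‖² ≥ 1 − δ and ‖Qφ‖² ≥ 1 − δ, then ‖Q(Pφ)‖² ≥ 1 − δ − 2√δ. -/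
/-- Pythagoras' theorem for an orthogonal projection given as a self-adjoint idempotent. -/
theorem IsSelfAdjoint.norm_sq_eq_add_norm_sub_sq_of_isIdempotentElem {𝕜 H : Type*} [RCLike 𝕜]
    [NormedAddCommGroup H] [InnerProductSpace 𝕜 H] [CompleteSpace H] {P : H →L[𝕜] H}
    (hPsa : IsSelfAdjoint P) (hPidem : IsIdempotentElem P) (x : H) :
    ‖x‖ ^ 2 = ‖P x‖ ^ 2 + ‖x - P x‖ ^ 2 := by
  have hPP : P (P x) = P x := DFunLike.congr_fun hPidem x
  have horth : inner 𝕜 (P x) (x - P x) = 0 := by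
    rw [← ContinuousLinearMap.adjoint_inner_right, hPsa.adjoint_eq, map_sub, hPP, sub_self,
      inner_zero_right]
  have h := norm_add_sq_eq_norm_sq_add_norm_sq_of_inner_eq_zero (P x) (x - P x) horth
  rw [add_sub_cancel] at h
  simpa only [sq] using h

/-- A self-adjoint idempotent is norm-nonincreasing. -/
theorem IsSelfAdjoint.norm_apply_le_of_isIdempotentElem {𝕜 H : Type*} [RCLike 𝕜]
    [NormedAddCommGroup H] [InnerProductSpace 𝕜 H] [CompleteSpace H] {P : H →L[𝕜] H}
    (hPsa : IsSelfAdjoint P) (hPidem : IsIdempotentElem P) (x : H) : ‖P x‖ ≤ ‖x‖ := by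
  refine (abs_le_of_sq_le_sq' ?_ (norm_nonneg x)).2
  rw [hPsa.norm_sq_eq_add_norm_sub_sq_of_isIdempotentElem hPidem x]
  exact le_add_of_nonneg_right (sq_nonneg _)

/-- Eq. (G.12): if `P` and `Q` are orthogonal projections on a complex Hilbert space
(continuous linear, idempotent, self-adjoint) and a unit vector `φ` satisfies
`‖Pφ‖² ≥ 1 - δ` and `‖Qφ‖² ≥ 1 - δ`, then `‖Q(Pφ)‖² ≥ 1 - δ - 2√δ`. -/
theorem norm_proj_proj_sq_ge {H : Type*} [NormedAddCommGroup H]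
    [InnerProductSpace ℂ H] [CompleteSpace H]
    (P Q : H →L[ℂ] H)
    (hPidem : IsIdempotentElem P) (hPsa : IsSelfAdjoint P)
    (hQidem : IsIdempotentElem Q) (hQsa : IsSelfAdjoint Q)
    (φ : H) (hφ : ‖φ‖ = 1) (δ : ℝ) (hδ : 0 ≤ δ)
    (hP : 1 - δ ≤ ‖P φ‖ ^ 2) (hQ : 1 - δ ≤ ‖Q φ‖ ^ 2) :
    1 - δ - 2 * Real.sqrt δ ≤ ‖Q (P φ)‖ ^ 2 := by
  have hs := Real.sqrt_nonneg δ
  have hs2 := Real.sq_sqrt hδ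
  have hpyth := hPsa.norm_sq_eq_add_norm_sub_sq_of_isIdempotentElem hPidem φ
  have hsub : ‖φ - P φ‖ ≤ √δ := Real.le_sqrt_of_sq_le (by rw [hφ] at hpyth; linarith)
  have hQφ : ‖Q φ‖ ≤ 1 := hφ ▸ hQsa.norm_apply_le_of_isIdempotentElem hQidem φ
  have htri : ‖Q φ‖ ≤ ‖Q (P φ)‖ + √δ := calc
    ‖Q φ‖ = ‖Q (P φ) + Q (φ - P φ)‖ := by rw [← map_add, add_sub_cancel]
    _ ≤ ‖Q (P φ)‖ + ‖Q (φ - P φ)‖ := norm_add_le _ _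
    _ ≤ ‖Q (P φ)‖ + √δ := by
      gcongr
      exact (hQsa.norm_apply_le_of_isIdempotentElem hQidem _).trans hsub
  have hQφ0 := norm_nonneg (Q φ)
  rcases le_total ‖Q φ‖ √δ with h | h
  · nlinarith [sq_nonneg ‖Q (P φ)‖]
  · nlinarith [pow_le_pow_left₀ (sub_nonneg.2 h) (sub_le_iff_le_add.2 htri) 2]
end

section
/- Let d ≥ 2 be an integer, L ≥ 2 an even integer, Δ > 0, and ε ∈ (0, 1/(2d)]. Then the family (Sha_{L,Δ}^ε(j)_d)_{j=0}^{d−1} is orthonormal in L²(ℝ): for every j ∈ {0,…,d−1} one has ∫_ℝ |Sha_{L,Δ}^ε(j)_d(y)|² dy = 1, and for all j ≠ k in {0,…,d−1} one has ∫_ℝ \overline{Sha_{L,Δ}^ε(j)_d(y)} · Sha_{L,Δ}^ε(k)_d(y) dy = 0. -/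
open MeasureTheory

/-- The normalized truncated Gaussian `Ψ_Δ^ε`: proportional to `e^{-x²/(2Δ²)}` on
`[-ε, ε]` and zero outside, normalized by `N^{-1/2}` with `N = ∫_{-ε}^{ε} e^{-t²/Δ²} dt`. -/
noncomputable def psiTrunc (Δ ε : ℝ) (x : ℝ) : ℝ :=
  if |x| ≤ ε then
    (Real.sqrt (∫ t in (-ε)..ε, Real.exp (-t ^ 2 / Δ ^ 2)))⁻¹ * Real.exp (-x ^ 2 / (2 * Δ ^ 2))
  else 0

/-- The rectangular-envelope approximate GKP basis state
`Sha_{L,Δ}^ε(j)_d(y) = L^{-1/2} (2πd)^{-1/4} Σ_{z=-L/2}^{L/2-1} Ψ_Δ^ε(y/√(2πd) - z - j/d)`. -/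
noncomputable def shaState (d L : ℕ) (Δ ε : ℝ) (j : ℕ) (y : ℝ) : ℝ :=
  (Real.sqrt L)⁻¹ * (2 * Real.pi * d) ^ (-(1 : ℝ) / 4) *
    ∑ z ∈ Finset.Icc (-(L : ℤ) / 2) ((L : ℤ) / 2 - 1),
      psiTrunc Δ ε (y / Real.sqrt (2 * Real.pi * d) - (z : ℝ) - (j : ℝ) / d)

lemma integral_exp_truncated_pos (Δ ε : ℝ) (hε : 0 < ε) :
    0 < ∫ t in (-ε)..ε, Real.exp (-t ^ 2 / Δ ^ 2) :=
  intervalIntegral.intervalIntegral_pos_of_pos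
    (Continuous.intervalIntegrable (by fun_prop) _ _) (fun _ => Real.exp_pos _) (by linarith)

lemma psiTrunc_mul_self (Δ ε : ℝ) (hε : 0 < ε) :
    (fun x => psiTrunc Δ ε x * psiTrunc Δ ε x) = (Set.Icc (-ε) ε).indicator
      (fun t => (∫ t in (-ε)..ε, Real.exp (-t ^ 2 / Δ ^ 2))⁻¹ * Real.exp (-t ^ 2 / Δ ^ 2)) := by
  have hN := integral_exp_truncated_pos Δ ε hε
  ext x
  by_cases hx : |x| ≤ ε
  · rw [Set.indicator_of_mem (Set.mem_Icc.2 (abs_le.1 hx))]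
    simp only [psiTrunc, if_pos hx]
    rw [mul_mul_mul_comm, ← mul_inv, Real.mul_self_sqrt hN.le, ← Real.exp_add]
    congr 2
    ring
  · rw [Set.indicator_of_notMem (fun h => hx (abs_le.2 (Set.mem_Icc.1 h)))]
    simp [psiTrunc, if_neg hx]

lemma integrable_psiTrunc_mul_self (Δ ε : ℝ) (hε : 0 < ε) :
    Integrable (fun x => psiTrunc Δ ε x * psiTrunc Δ ε x) := by
  rw [psiTrunc_mul_self Δ ε hε, integrable_indicator_iff measurableSet_Icc]
  exact Continuous.integrableOn_Icc (by fun_prop)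

lemma integral_psiTrunc_mul_self (Δ ε : ℝ) (hε : 0 < ε) :
    ∫ x, psiTrunc Δ ε x * psiTrunc Δ ε x = 1 := by
  rw [psiTrunc_mul_self Δ ε hε, integral_indicator measurableSet_Icc,
    integral_Icc_eq_integral_Ioc, ← intervalIntegral.integral_of_le (by linarith),
    intervalIntegral.integral_const_mul]
  exact inv_mul_cancel₀ (integral_exp_truncated_pos Δ ε hε).ne'

/-- Translates of the truncated Gaussian by at least `2ε` overlap in at most one point. -/
lemma psiTrunc_translate_mul_ae_eq_zero (Δ ε a b : ℝ) (hab : 2 * ε ≤ |a - b|) :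
    (fun x => psiTrunc Δ ε (x - a) * psiTrunc Δ ε (x - b)) =ᵐ[volume] fun _ => 0 := by
  filter_upwards [Measure.ae_ne volume ((a + b) / 2)] with x hx
  by_contra h
  have ha : |x - a| ≤ ε := by
    by_contra h'
    simp [psiTrunc, h'] at h
  have hb : |x - b| ≤ ε := by
    by_contra h'
    simp [psiTrunc, h'] at h
  rw [abs_le] at ha hb
  apply hx
  rcases le_abs.1 hab with h | h <;> linarith

lemma integrable_psiTrunc_translate_mul (Δ ε a b : ℝ) (hε : 0 < ε)
    (hab : a = b ∨ 2 * ε ≤ |a - b|) :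
    Integrable (fun x => psiTrunc Δ ε (x - a) * psiTrunc Δ ε (x - b)) := by
  rcases hab with rfl | hab
  · exact (integrable_psiTrunc_mul_self Δ ε hε).comp_sub_right a
  · exact (integrable_congr (psiTrunc_translate_mul_ae_eq_zero Δ ε a b hab)).2
      (integrable_zero _ _ _)

lemma integral_psiTrunc_translate_mul (Δ ε a b : ℝ) (hε : 0 < ε)
    (hab : a = b ∨ 2 * ε ≤ |a - b|) :
    ∫ x, psiTrunc Δ ε (x - a) * psiTrunc Δ ε (x - b) = if a = b then 1 else 0 := by
  rcases hab with rfl | hab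
  · rw [if_pos rfl, integral_sub_right_eq_self (fun x => psiTrunc Δ ε x * psiTrunc Δ ε x) a,
      integral_psiTrunc_mul_self Δ ε hε]
  · rw [integral_congr_ae (psiTrunc_translate_mul_ae_eq_zero Δ ε a b hab), integral_zero,
      if_neg]
    rintro rfl
    simp at hab
    linarith

lemma gkp_index_injective {d j k : ℕ} (hj : j < d) (hk : k < d) {z w : ℤ}
    (h : z * d + j = w * d + k) : z = w ∧ j = k := by
  have hd : (d : ℤ) ≠ 0 := by omega
  have hjk : (j : ℤ) = k := by
    have := congrArg (· % (d : ℤ)) h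
    simpa [Int.add_emod, Int.emod_eq_of_lt, hj, hk] using this
  refine ⟨mul_right_cancel₀ hd (by linarith), by exact_mod_cast hjk⟩

/-- Distinct peak positions `z + j/d` are at distance at least `1/d`. -/
lemma gkp_peak_eq_or_separated {d j k : ℕ} (hd : 0 < d) (z w : ℤ) {ε : ℝ}
    (hεd : ε ≤ 1 / (2 * d)) :
    (z + j / d : ℝ) = w + k / d ∨ 2 * ε ≤ |(z + j / d : ℝ) - (w + k / d)| := by
  have hd' : (0 : ℝ) < d := by exact_mod_cast hd
  have key : (z + j / d : ℝ) - (w + k / d) = ((z * d + j - (w * d + k) : ℤ) : ℝ) / d := by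
    push_cast
    field_simp
  by_cases h : z * d + j - (w * d + k) = 0
  · left
    rw [← sub_eq_zero, key, h]
    simp
  · right
    rw [key, abs_div, abs_of_pos hd', le_div_iff₀ hd']
    have h1 : (1 : ℝ) ≤ |((z * d + j - (w * d + k) : ℤ) : ℝ)| := by
      exact_mod_cast Int.one_le_abs h
    rw [le_div_iff₀ (by positivity)] at hεd
    linarith

lemma gkp_peak_eq_iff {d j k : ℕ} (hj : j < d) (hk : k < d) (z w : ℤ) :
    (z + j / d : ℝ) = w + k / d ↔ z = w ∧ j = k := by
  constructor
  · intro h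
    have hd' : (d : ℝ) ≠ 0 := by
      have : d ≠ 0 := by omega
      exact_mod_cast this
    field_simp at h
    exact gkp_index_injective hj hk (by exact_mod_cast (by linarith : (z * d + j : ℝ) = w * d + k))
  · rintro ⟨rfl, rfl⟩
    rfl

lemma shaState_prefactor_mul_self {d L : ℕ} (hd : 0 < d) :
    ((Real.sqrt L)⁻¹ * (2 * Real.pi * d) ^ (-(1 : ℝ) / 4)) *
      ((Real.sqrt L)⁻¹ * (2 * Real.pi * d) ^ (-(1 : ℝ) / 4)) * Real.sqrt (2 * Real.pi * d)
      = (L : ℝ)⁻¹ := by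
  have hp : 0 < 2 * Real.pi * d := by positivity
  rw [mul_mul_mul_comm, ← mul_inv, Real.mul_self_sqrt (Nat.cast_nonneg L), mul_assoc,
    Real.sqrt_eq_rpow, ← Real.rpow_add hp, ← Real.rpow_add hp]
  norm_num

lemma integral_shaState_mul_shaState (d L : ℕ) (hL : 0 < L) (hLeven : Even L)
    (Δ ε : ℝ) (hε : 0 < ε) (hεd : ε ≤ 1 / (2 * d)) {j k : ℕ} (hj : j < d) (hk : k < d) :
    ∫ y : ℝ, shaState d L Δ ε j y * shaState d L Δ ε k y = if j = k then 1 else 0 := by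
  have hd : 0 < d := by omega
  set c : ℝ := (Real.sqrt L)⁻¹ * (2 * Real.pi * d) ^ (-(1 : ℝ) / 4) with hc
  set s : ℝ := Real.sqrt (2 * Real.pi * d) with hs
  set I := Finset.Icc (-(L : ℤ) / 2) ((L : ℤ) / 2 - 1) with hI
  have hs_pos : 0 < s := Real.sqrt_pos.2 (by positivity)
  have hcard : (I.card : ℝ) = L := by
    obtain ⟨m, rfl⟩ := hLeven
    have : I.card = m + m := by
      rw [hI, Int.card_Icc]
      push_cast
      omega
    rw [this]
  have hprod : ∀ y, shaState d L Δ ε j y * shaState d L Δ ε k y =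
      c * c * ∑ z ∈ I, ∑ w ∈ I, psiTrunc Δ ε (y / s - (z + j / d)) *
        psiTrunc Δ ε (y / s - (w + k / d)) := by
    intro y
    simp only [shaState, ← hc, ← hs, ← hI, sub_sub]
    rw [mul_mul_mul_comm, Finset.sum_mul_sum]
  have hint : ∀ z w : ℤ, Integrable (fun x => psiTrunc Δ ε (x - (z + j / d)) *
      psiTrunc Δ ε (x - (w + k / d))) := fun z w =>
    integrable_psiTrunc_translate_mul Δ ε _ _ hε (gkp_peak_eq_or_separated hd z w hεd)
  simp only [hprod]
  rw [integral_const_mul, Measure.integral_comp_div (fun x => ∑ z ∈ I, ∑ w ∈ I,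
      psiTrunc Δ ε (x - (z + j / d)) * psiTrunc Δ ε (x - (w + k / d))) s,
    integral_finsetSum _ fun z _ => integrable_finsetSum _ fun w _ => hint z w]
  have hsum : ∀ z ∈ I, ∫ x, ∑ w ∈ I, psiTrunc Δ ε (x - (z + j / d)) *
      psiTrunc Δ ε (x - (w + k / d)) = if j = k then 1 else 0 := by
    intro z hz
    rw [integral_finsetSum _ fun w _ => hint z w]
    simp only [fun w : ℤ => integral_psiTrunc_translate_mul Δ ε (z + j / d) (w + k / d) hε
      (gkp_peak_eq_or_separated hd z w hεd), gkp_peak_eq_iff hj hk]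
    by_cases hjk : j = k <;> simp [hjk, hz]
  rw [Finset.sum_congr rfl hsum, Finset.sum_const, nsmul_eq_mul, hcard, abs_of_pos hs_pos,
    smul_eq_mul, ← mul_assoc, ← mul_assoc, shaState_prefactor_mul_self hd,
    inv_mul_cancel₀ (by positivity), one_mul]

/-- For `ε ≤ 1/(2d)`, the family `(Sha_{L,Δ}^ε(j)_d)_{j=0}^{d-1}` is orthonormal in
`L²(ℝ)`: each state is normalized and distinct states are orthogonal. -/
theorem shaState_orthonormal (d L : ℕ) (hd : 2 ≤ d) (hL : 2 ≤ L) (hLeven : Even L)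
    (Δ ε : ℝ) (hΔ : 0 < Δ) (hε : 0 < ε) (hεd : ε ≤ 1 / (2 * d)) :
    (∀ j, j < d → ∫ y : ℝ, (shaState d L Δ ε j y) ^ 2 = 1) ∧
      (∀ j k, j < d → k < d → j ≠ k →
        ∫ y : ℝ, shaState d L Δ ε j y * shaState d L Δ ε k y = 0) := by
  refine ⟨fun j hj => ?_, fun j k hj hk hjk => ?_⟩
  · simp only [sq]
    rw [integral_shaState_mul_shaState d L (by omega) hLeven Δ ε hε hεd hj hj, if_pos rfl]
  · rw [integral_shaState_mul_shaState d L (by omega) hLeven Δ ε hε hεd hj hk, if_neg hjk]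
end

section
/- Let d ≥ 2 be an integer, L ≥ 2 an even integer, Δ > 0, and ε ∈ (0, 1/(2d)]. Let j ∈ {0,…,d−1} and let y ∈ ℝ satisfy Sha_{L,Δ}^ε(j)_d(y) ≠ 0. Then: (1) there exists an integer z with −L/2 ≤ z ≤ L/2 − 1 such that |y − √(2π/d)·j − √(2πd)·z| ≤ √(2πd)·ε ≤ √(π/(2d)); and (2) setting t := y·√(d/(2π)), every integer n with |t − n| ≤ 1/2 satisfies n ≡ j (mod d), provided t + 1/2 ∉ ℤ (i.e. t is not a half-integer). -/
open MeasureTheory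

theorem abs_le_of_psiTrunc_ne_zero {Δ ε x : ℝ} (h : psiTrunc Δ ε x ≠ 0) : |x| ≤ ε := by
  by_contra hx
  exact h (if_neg hx)

theorem exists_abs_sub_le_of_shaState_ne_zero {d L : ℕ} {Δ ε : ℝ} {j : ℕ} {y : ℝ}
    (h : shaState d L Δ ε j y ≠ 0) :
    ∃ z ∈ Finset.Icc (-(L : ℤ) / 2) ((L : ℤ) / 2 - 1),
      |y / Real.sqrt (2 * Real.pi * d) - (z : ℝ) - (j : ℝ) / d| ≤ ε := by
  obtain ⟨z, hz, hne⟩ := Finset.exists_ne_zero_of_sum_ne_zero (right_ne_zero_of_mul h)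
  exact ⟨z, hz, abs_le_of_psiTrunc_ne_zero hne⟩

/-- Away from half-integers, the nearest integer to a real number is unique. -/
theorem eq_of_abs_sub_le_half {t : ℝ} (ht : ¬ ∃ k : ℤ, t + 1 / 2 = (k : ℝ)) {m n : ℤ}
    (hm : |t - m| ≤ 1 / 2) (hn : |t - n| ≤ 1 / 2) : n = m := by
  rw [abs_le] at hm hn
  rcases lt_trichotomy n m with h | h | h
  · have h' : (n : ℝ) + 1 ≤ m := by exact_mod_cast h
    exact absurd ⟨m, by linarith⟩ ht
  · exact h
  · have h' : (m : ℝ) + 1 ≤ n := by exact_mod_cast h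
    exact absurd ⟨n, by linarith⟩ ht

/-- Lemma 1 (support characterization and readout): if `Sha_{L,Δ}^ε(j)_d(y) ≠ 0` then
(1) `y` lies within `√(2πd)·ε ≤ √(π/(2d))` of a lattice point `√(2π/d)j + √(2πd)z` with
`-L/2 ≤ z ≤ L/2 - 1`, and (2) provided `t := y·√(d/(2π))` is not a half-integer, every
integer `n` with `|t - n| ≤ 1/2` satisfies `n ≡ j (mod d)`. -/
theorem shaState_support_and_readout (d L : ℕ) (hd : 2 ≤ d) (hL : 2 ≤ L)
    (hLeven : Even L) (Δ ε : ℝ) (hΔ : 0 < Δ) (hε : 0 < ε) (hεd : ε ≤ 1 / (2 * d))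
    (j : ℕ) (hj : j < d) (y : ℝ) (hy : shaState d L Δ ε j y ≠ 0) :
    (∃ z : ℤ, -(L : ℤ) / 2 ≤ z ∧ z ≤ (L : ℤ) / 2 - 1 ∧
        |y - Real.sqrt (2 * Real.pi / d) * j - Real.sqrt (2 * Real.pi * d) * z| ≤
          Real.sqrt (2 * Real.pi * d) * ε ∧
        Real.sqrt (2 * Real.pi * d) * ε ≤ Real.sqrt (Real.pi / (2 * d))) ∧
      ((¬ ∃ k : ℤ, y * Real.sqrt (d / (2 * Real.pi)) + 1 / 2 = (k : ℝ)) →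
        ∀ n : ℤ, |y * Real.sqrt (d / (2 * Real.pi)) - (n : ℝ)| ≤ 1 / 2 →
          n ≡ (j : ℤ) [ZMOD (d : ℤ)]) := by
  have hd0 : (0 : ℝ) < d := by exact_mod_cast (by omega : 0 < d)
  obtain ⟨z, hz, hyz⟩ := exists_abs_sub_le_of_shaState_ne_zero hy
  obtain ⟨hz₁, hz₂⟩ := Finset.mem_Icc.mp hz
  have hs : 0 < Real.sqrt (2 * Real.pi * d) := Real.sqrt_pos.mpr (by positivity)
  have hsq : Real.sqrt (2 * Real.pi * d) ^ 2 = 2 * Real.pi * d := Real.sq_sqrt (by positivity)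
  have hstep : Real.sqrt (2 * Real.pi / d) = Real.sqrt (2 * Real.pi * d) / d := by
    rw [Real.sqrt_eq_iff_mul_self_eq (by positivity) (by positivity), ← sq, div_pow, hsq]
    field_simp
  have hinv : Real.sqrt (d / (2 * Real.pi)) = d / Real.sqrt (2 * Real.pi * d) := by
    rw [Real.sqrt_eq_iff_mul_self_eq (by positivity) (by positivity), ← sq, div_pow, hsq]
    field_simp
  have hhalf : Real.sqrt (Real.pi / (2 * d)) = Real.sqrt (2 * Real.pi * d) * (1 / (2 * d)) := by
    rw [Real.sqrt_eq_iff_mul_self_eq (by positivity) (by positivity), ← sq, mul_pow, hsq]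
    field_simp
  rw [hstep, hinv, hhalf]
  set s := Real.sqrt (2 * Real.pi * d)
  refine ⟨⟨z, hz₁, hz₂, ?_, by gcongr⟩, fun ht n hn => ?_⟩
  · have hscale : y - s / d * j - s * z = s * (y / s - z - j / d) := by
      field_simp
      ring
    rw [hscale, abs_mul, abs_of_pos hs]
    gcongr
  · have hm : |y * (d / s) - ((d * z + j : ℤ) : ℝ)| ≤ 1 / 2 := by
      have hscale : y * (d / s) - ((d * z + j : ℤ) : ℝ) = d * (y / s - z - j / d) := by
        push_cast
        field_simp
        ring
      rw [hscale, abs_mul, abs_of_pos hd0]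
      calc (d : ℝ) * |y / s - z - j / d| ≤ d * (1 / (2 * d)) := by
            gcongr
            exact hyz.trans hεd
        _ = 1 / 2 := by field_simp
    rw [eq_of_abs_sub_le_half ht hm hn]
    simp [Int.ModEq]
end

section
/- Let L ≥ 1 and let l_1, …, l_L be finite sequences of positive real numbers. Then ḡ(l_1 ⧺ ⋯ ⧺ l_L) ≤ (max_{1 ≤ a ≤ L} ḡ(l_a))² · ∏_{a=1}^{L} g(Π(l_a)), where Π(l) denotes the product of all entries of the sequence l and ⧺ denotes concatenation. -/
/-- `g(x) = max{x, 1/x}`. -/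
noncomputable def gfun (x : ℝ) : ℝ := max x x⁻¹

/-- The squeezing parameter `ḡ` of a finite sequence of squeezing strengths:
the maximum of `g` over the products of all contiguous subsequences
(with the convention `ḡ = 1` for the empty sequence, realized by the empty
contiguous subsequence). -/
noncomputable def gbar (l : List ℝ) : ℝ :=
  sSup {x : ℝ | ∃ l₁ l₂ l₃ : List ℝ, l = l₁ ++ l₂ ++ l₃ ∧ x = gfun l₂.prod}

theorem one_le_gfun {x : ℝ} (hx : 0 < x) : 1 ≤ gfun x := by
  rcases le_total 1 x with h | h
  · exact le_max_of_le_left h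
  · exact le_max_of_le_right ((one_le_inv₀ hx).mpr h)

theorem gfun_mul_le {x y : ℝ} (hx : 0 < x) (hy : 0 < y) : gfun (x * y) ≤ gfun x * gfun y := by
  unfold gfun
  refine max_le ?_ ?_
  · gcongr <;> exact le_max_left _ _
  · rw [mul_inv]
    gcongr <;> exact le_max_right _ _

theorem gfun_prod_le_gbar {l l₁ l₂ l₃ : List ℝ} (h : l = l₁ ++ l₂ ++ l₃) :
    gfun l₂.prod ≤ gbar l := by
  refine le_csSup (Set.Finite.bddAbove ?_) ⟨l₁, l₂, l₃, h, rfl⟩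
  refine (l.sublists.finite_toSet.image fun s => gfun s.prod).subset ?_
  rintro _ ⟨a, s, b, hs, rfl⟩
  exact ⟨s, List.mem_sublists.mpr (List.IsInfix.sublist ⟨a, b, hs.symm⟩), rfl⟩

theorem one_le_gbar (l : List ℝ) : 1 ≤ gbar l := by
  simpa [gfun] using gfun_prod_le_gbar (l := l) (l₁ := []) (l₂ := []) (l₃ := l) (by simp)

theorem gbar_le {l : List ℝ} {C : ℝ}
    (h : ∀ l₁ l₂ l₃ : List ℝ, l = l₁ ++ l₂ ++ l₃ → gfun l₂.prod ≤ C) : gbar l ≤ C := by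
  refine csSup_le ⟨_, [], [], l, by simp, rfl⟩ ?_
  rintro _ ⟨a, s, b, hs, rfl⟩
  exact h a s b hs

theorem one_le_prod_map_gfun {LL : List (List ℝ)} (hpos : ∀ l ∈ LL, ∀ x ∈ l, 0 < x) :
    1 ≤ (LL.map fun l => gfun l.prod).prod := by
  induction LL with
  | nil => simp
  | cons l t ih =>
    rw [List.forall_mem_cons] at hpos
    rw [List.map_cons, List.prod_cons]
    exact one_le_mul_of_one_le_of_one_le (one_le_gfun (List.prod_pos hpos.1)) (ih hpos.2)

theorem gfun_prod_prefix_flatten_le {M : ℝ} (hM : 1 ≤ M) {LL : List (List ℝ)}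
    (hpos : ∀ l ∈ LL, ∀ x ∈ l, 0 < x) (hb : ∀ l ∈ LL, gbar l ≤ M) {s b : List ℝ}
    (h : LL.flatten = s ++ b) :
    gfun s.prod ≤ M * (LL.map fun l => gfun l.prod).prod := by
  induction LL generalizing s with
  | nil =>
    obtain ⟨rfl, rfl⟩ : s = [] ∧ b = [] := by simpa using h
    simpa [gfun] using hM
  | cons l t ih =>
    have hP := one_le_prod_map_gfun hpos
    rw [List.forall_mem_cons] at hpos hb
    rw [List.flatten_cons, List.append_eq_append_iff] at h
    rcases h with ⟨s', rfl, h⟩ | ⟨c, rfl, -⟩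
    · have hs' : ∀ x ∈ s', 0 < x := fun x hx => by
        have hmem : x ∈ t.flatten := by simp [h, hx]
        obtain ⟨l', hl', hxl'⟩ := List.mem_flatten.mp hmem
        exact hpos.2 l' hl' x hxl'
      have hl := one_le_gfun (List.prod_pos hpos.1)
      rw [List.prod_append, List.map_cons, List.prod_cons]
      calc gfun (l.prod * s'.prod) ≤ gfun l.prod * gfun s'.prod :=
            gfun_mul_le (List.prod_pos hpos.1) (List.prod_pos hs')
        _ ≤ gfun l.prod * (M * (t.map fun l => gfun l.prod).prod) := by
            gcongr
            exact ih hpos.2 hb.2 h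
        _ = _ := by ring
    · exact ((gfun_prod_le_gbar (l₁ := []) (l₃ := c) (by simp)).trans hb.1).trans
        (le_mul_of_one_le_right (by linarith) hP)

theorem gbar_flatten_le {M : ℝ} (hM : 1 ≤ M) {LL : List (List ℝ)}
    (hpos : ∀ l ∈ LL, ∀ x ∈ l, 0 < x) (hb : ∀ l ∈ LL, gbar l ≤ M) :
    gbar LL.flatten ≤ M ^ 2 * (LL.map fun l => gfun l.prod).prod := by
  refine gbar_le fun a s b h => ?_
  induction LL generalizing a with
  | nil =>
    obtain ⟨rfl, rfl, rfl⟩ : a = [] ∧ s = [] ∧ b = [] := by simpa using h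
    simpa only [gfun, List.prod_nil, inv_one, max_self, List.map_nil, mul_one] using one_le_pow₀ hM
  | cons l t ih =>
    have hP := one_le_prod_map_gfun hpos
    rw [List.forall_mem_cons] at hpos hb
    have hl := one_le_gfun (List.prod_pos hpos.1)
    have hPt := one_le_prod_map_gfun hpos.2
    rw [List.flatten_cons, List.append_assoc, List.append_eq_append_iff] at h
    rcases h with ⟨a', rfl, h⟩ | ⟨c, rfl, h⟩
    · have := ih hpos.2 hb.2 a' (by rw [h, List.append_assoc])
      rw [List.map_cons, List.prod_cons]
      refine this.trans ?_
      gcongr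
      exact le_mul_of_one_le_left (by linarith) hl
    · rw [eq_comm, List.append_eq_append_iff] at h
      rcases h with ⟨s', rfl, h⟩ | ⟨d, rfl, -⟩
      · have hc : ∀ x ∈ c, 0 < x := fun x hx => hpos.1 x (by simp [hx])
        have hs' : ∀ x ∈ s', 0 < x := fun x hx => by
          have hmem : x ∈ t.flatten := by simp [h, hx]
          obtain ⟨l', hl', hxl'⟩ := List.mem_flatten.mp hmem
          exact hpos.2 l' hl' x hxl'
        have hcM : gfun c.prod ≤ M :=
          (gfun_prod_le_gbar (l₁ := a) (l₃ := []) (by simp)).trans hb.1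
        rw [List.prod_append, List.map_cons, List.prod_cons]
        calc gfun (c.prod * s'.prod) ≤ gfun c.prod * gfun s'.prod :=
              gfun_mul_le (List.prod_pos hc) (List.prod_pos hs')
          _ ≤ M * (M * (t.map fun l => gfun l.prod).prod) := by
              have h1 := one_le_gfun (List.prod_pos hs')
              gcongr
              exact gfun_prod_prefix_flatten_le hM hpos.2 hb.2 h
          _ = M ^ 2 * (t.map fun l => gfun l.prod).prod := by ring
          _ ≤ _ := by
              gcongr
              exact le_mul_of_one_le_left (by linarith) hl
      · have hsM : gfun s.prod ≤ M :=
          (gfun_prod_le_gbar (l₁ := a) (l₃ := d) (by simp)).trans hb.1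
        calc gfun s.prod ≤ M := hsM
          _ ≤ M ^ 2 := le_self_pow₀ hM two_ne_zero
          _ ≤ _ := le_mul_of_one_le_right (by positivity) hP

/-- Lemma C.8, second bound:
`ḡ(l_1 ⧺ ⋯ ⧺ l_L) ≤ (max_a ḡ(l_a))² · ∏_a g(Π(l_a))`. -/
theorem gbar_join_le_sq_max_mul_prod (L : ℕ) (hL : 1 ≤ L) (l : Fin L → List ℝ)
    (hpos : ∀ a, ∀ x ∈ l a, 0 < x) :
    gbar (List.ofFn l).flatten ≤
      (Finset.univ.sup' (Finset.univ_nonempty_iff.mpr ⟨⟨0, hL⟩⟩)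
          fun a => gbar (l a)) ^ 2 * ∏ a, gfun (l a).prod := by
  have hle : ∀ a, gbar (l a) ≤ Finset.univ.sup'
      (Finset.univ_nonempty_iff.mpr ⟨⟨0, hL⟩⟩) fun a => gbar (l a) :=
    fun a => Finset.le_sup' (fun a => gbar (l a)) (Finset.mem_univ a)
  have h := gbar_flatten_le (LL := List.ofFn l) ((one_le_gbar _).trans (hle ⟨0, hL⟩))
    (List.forall_mem_ofFn_iff.mpr hpos) (List.forall_mem_ofFn_iff.mpr hle)
  rwa [List.map_ofFn, List.prod_ofFn] at h
end

section
/- For all real numbers η > 0, ξ ≥ 0 and x ∈ ℝ, one has ( Σ over natural numbers z ≥ 1 with ηz − η − ξ ≤ x ≤ ηz + ξ of z² ) + ( Σ over natural numbers z ≥ 1 with −ηz − ξ ≤ x ≤ −ηz + η + ξ of z² ) ≤ (2ξ/η + 2) · ( (x/η + 3ξ/η + 1)² + (−x/η + ξ/η + 1)² ). In particular, both index sets are finite, so the sums are well defined. -/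
theorem Nat.setOf_one_le_and_mem_interval_eq_Icc {a b : ℝ} :
    {z : ℕ | 1 ≤ z ∧ a ≤ z ∧ (z : ℝ) ≤ b} = Finset.Icc (max 1 ⌈a⌉₊) ⌊b⌋₊ := by
  ext z
  simp only [Set.mem_ofPred_eq, Finset.coe_Icc, Set.mem_Icc, max_le_iff, Nat.ceil_le, and_assoc]
  refine and_congr_right fun hz ↦ and_congr_right fun _ ↦ ?_
  rw [Nat.le_floor_iff' (by omega)]

theorem finsum_sq_le_of_interval {a b : ℝ} (hab : a ≤ b) :
    ∑ᶠ z ∈ {z : ℕ | 1 ≤ z ∧ a ≤ z ∧ (z : ℝ) ≤ b}, (z : ℝ) ^ 2 ≤ (b - a + 1) * b ^ 2 := by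
  rw [Nat.setOf_one_le_and_mem_interval_eq_Icc, finsum_mem_coe_finset]
  have hterm : ∀ z ∈ Finset.Icc (max 1 ⌈a⌉₊) ⌊b⌋₊, (z : ℝ) ^ 2 ≤ b ^ 2 := fun z hz ↦ by
    rw [Finset.mem_Icc, max_le_iff, Nat.le_floor_iff' (by grind)] at hz
    gcongr
    exact hz.2
  have hcard : ((Finset.Icc (max 1 ⌈a⌉₊) ⌊b⌋₊).card : ℝ) ≤ b - a + 1 := by
    rw [Nat.card_Icc]
    rcases le_total (max 1 ⌈a⌉₊) (⌊b⌋₊ + 1) with h | h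
    · have hb : (⌊b⌋₊ : ℝ) - (max 1 ⌈a⌉₊ : ℕ) ≤ b - a := by
        have ha : a ≤ (max 1 ⌈a⌉₊ : ℕ) :=
          (Nat.le_ceil a).trans (by exact_mod_cast le_max_right _ _)
        rcases le_total 0 b with hb | hb
        · linarith [Nat.floor_le hb]
        · have : (1 : ℝ) ≤ (max 1 ⌈a⌉₊ : ℕ) := by exact_mod_cast le_max_left _ _
          rw [Nat.floor_of_nonpos hb] at h ⊢
          have : max 1 ⌈a⌉₊ = 1 := by omega
          rw [this]
          push_cast
          linarith
      rw [Nat.cast_sub h]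
      push_cast at hb ⊢
      linarith
    · rw [Nat.sub_eq_zero_of_le h]
      push_cast
      linarith
  calc ∑ z ∈ Finset.Icc (max 1 ⌈a⌉₊) ⌊b⌋₊, (z : ℝ) ^ 2
      ≤ (Finset.Icc (max 1 ⌈a⌉₊) ⌊b⌋₊).card * b ^ 2 := by
        simpa using Finset.sum_le_card_nsmul _ _ _ hterm
    _ ≤ (b - a + 1) * b ^ 2 := by gcongr

theorem finsum_sq_le_of_interval_of_le {a b c : ℝ} (hab : a ≤ b) (hbc : b ≤ c) :
    ∑ᶠ z ∈ {z : ℕ | 1 ≤ z ∧ a ≤ z ∧ (z : ℝ) ≤ b}, (z : ℝ) ^ 2 ≤ (b - a + 1) * c ^ 2 := by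
  rcases le_total 0 b with hb | hb
  · refine (finsum_sq_le_of_interval hab).trans ?_
    have : 0 ≤ b - a + 1 := by linarith
    gcongr
  · have : {z : ℕ | 1 ≤ z ∧ a ≤ z ∧ (z : ℝ) ≤ b} = ∅ := by
      simp [Nat.setOf_one_le_and_mem_interval_eq_Icc, Nat.floor_of_nonpos hb]
    rw [this, finsum_mem_empty]
    have : 0 ≤ b - a + 1 := by linarith
    positivity

/-- The pointwise bound `ω(x) ≤ (2ξ/η + 2)((x/η + 3ξ/η + 1)² + (−x/η + ξ/η + 1)²)` from
the proof of Lemma C.4: the index sets are finite and the sums of `z²` over them are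
bounded by the stated quadratic expression. -/
theorem omega_pointwise_bound (η ξ x : ℝ) (hη : 0 < η) (hξ : 0 ≤ ξ) :
    {z : ℕ | 1 ≤ z ∧ η * z - η - ξ ≤ x ∧ x ≤ η * z + ξ}.Finite ∧
    {z : ℕ | 1 ≤ z ∧ -η * z - ξ ≤ x ∧ x ≤ -η * z + η + ξ}.Finite ∧
    (∑ᶠ z ∈ {z : ℕ | 1 ≤ z ∧ η * z - η - ξ ≤ x ∧ x ≤ η * z + ξ}, (z : ℝ) ^ 2) +
        (∑ᶠ z ∈ {z : ℕ | 1 ≤ z ∧ -η * z - ξ ≤ x ∧ x ≤ -η * z + η + ξ}, (z : ℝ) ^ 2) ≤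
      (2 * ξ / η + 2) * ((x / η + 3 * ξ / η + 1) ^ 2 + (-x / η + ξ / η + 1) ^ 2) := by
  have hs : 0 ≤ ξ / η := by positivity
  have hA : {z : ℕ | 1 ≤ z ∧ η * z - η - ξ ≤ x ∧ x ≤ η * z + ξ} =
      {z : ℕ | 1 ≤ z ∧ x / η - ξ / η ≤ z ∧ (z : ℝ) ≤ x / η + ξ / η + 1} := by
    ext z
    have hl : x / η - ξ / η ≤ z ↔ x ≤ η * z + ξ := by
      rw [← sub_div, div_le_iff₀ hη]
      constructor <;> intro h <;> linarith
    have hu : (z : ℝ) ≤ x / η + ξ / η + 1 ↔ η * z - η - ξ ≤ x := by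
      rw [← sub_le_iff_le_add, ← add_div, le_div_iff₀ hη]
      constructor <;> intro h <;> linarith
    simp only [Set.mem_ofPred_eq, hl, hu]
    tauto
  have hB : {z : ℕ | 1 ≤ z ∧ -η * z - ξ ≤ x ∧ x ≤ -η * z + η + ξ} =
      {z : ℕ | 1 ≤ z ∧ -x / η - ξ / η ≤ z ∧ (z : ℝ) ≤ -x / η + ξ / η + 1} := by
    ext z
    have hl : -x / η - ξ / η ≤ z ↔ -η * z - ξ ≤ x := by
      rw [← sub_div, div_le_iff₀ hη]
      constructor <;> intro h <;> linarith
    have hu : (z : ℝ) ≤ -x / η + ξ / η + 1 ↔ x ≤ -η * z + η + ξ := by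
      rw [← sub_le_iff_le_add, ← add_div, le_div_iff₀ hη]
      constructor <;> intro h <;> linarith
    simp only [Set.mem_ofPred_eq, hl, hu]
  rw [hA, hB]
  refine ⟨?_, ?_, ?_⟩
  · rw [Nat.setOf_one_le_and_mem_interval_eq_Icc]
    exact Finset.finite_toSet _
  · rw [Nat.setOf_one_le_and_mem_interval_eq_Icc]
    exact Finset.finite_toSet _
  · have h₁ := finsum_sq_le_of_interval_of_le (a := x / η - ξ / η) (b := x / η + ξ / η + 1)
      (c := x / η + 3 * ξ / η + 1) (by linarith) (by rw [mul_div_assoc]; linarith)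
    have h₂ := finsum_sq_le_of_interval (a := -x / η - ξ / η) (b := -x / η + ξ / η + 1)
      (by linarith)
    refine (add_le_add h₁ h₂).trans_eq ?_
    ring
end
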